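/- arXiv:2006.08990 — 9 statements merged into one kernel-verified Lean document; each statement's English description precedes it below -/
import Mathlib

section
/- The correlation P^G admits a 2←3 time-ordered bilocal decomposition across the partition 1|23; that is, P^G ∈ ATOBL_{2←3}. -/
open scoped BigOperators

/-- A tripartite binary correlation: `p o1 o2 o3 i1 i2 i3` is the probability of
outputs `(o1,o2,o3)` given inputs `(i1,i2,i3)`, all binary. -/
abbrev TriCorr := Fin 2 → Fin 2 → Fin 2 → Fin 2 → Fin 2 → Fin 2 → ℝ

/-- `p` is a valid tripartite binary correlation: nonnegative and normalized. -/
def IsTriCorr (p : TriCorr) : Prop :=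
  (∀ o1 o2 o3 i1 i2 i3, 0 ≤ p o1 o2 o3 i1 i2 i3) ∧
  (∀ i1 i2 i3, (∑ o1, ∑ o2, ∑ o3, p o1 o2 o3 i1 i2 i3) = 1)

/-- `p` admits a 2←3 asymmetric time-ordered bilocal model across 1|23:
bilocal decomposition whose bipartite terms are no-signaling from party 2 to
party 3 (the marginal `∑ o2, p23 l o2 o3 i2 i3` is independent of `i2`). -/
def ATOBL_left (p : TriCorr) : Prop :=
  ∃ (n : ℕ) (q : Fin n → ℝ)
    (p1 : Fin n → Fin 2 → Fin 2 → ℝ)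
    (p23 : Fin n → Fin 2 → Fin 2 → Fin 2 → Fin 2 → ℝ),
    (∀ l, 0 ≤ q l) ∧ (∑ l, q l) = 1 ∧
    (∀ l o1 i1, 0 ≤ p1 l o1 i1) ∧ (∀ l i1, (∑ o1, p1 l o1 i1) = 1) ∧
    (∀ l o2 o3 i2 i3, 0 ≤ p23 l o2 o3 i2 i3) ∧
    (∀ l i2 i3, (∑ o2, ∑ o3, p23 l o2 o3 i2 i3) = 1) ∧
    (∀ l o3 i2 i2' i3, (∑ o2, p23 l o2 o3 i2 i3) = ∑ o2, p23 l o2 o3 i2' i3) ∧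
    (∀ o1 o2 o3 i1 i2 i3,
      p o1 o2 o3 i1 i2 i3 = ∑ l, q l * p1 l o1 i1 * p23 l o2 o3 i2 i3)

/-- `p` admits a 2→3 asymmetric time-ordered bilocal model across 1|23:
bilocal decomposition whose bipartite terms are no-signaling from party 3 to
party 2 (the marginal `∑ o3, p23 l o2 o3 i2 i3` is independent of `i3`). -/
def ATOBL_right (p : TriCorr) : Prop :=
  ∃ (n : ℕ) (q : Fin n → ℝ)
    (p1 : Fin n → Fin 2 → Fin 2 → ℝ)
    (p23 : Fin n → Fin 2 → Fin 2 → Fin 2 → Fin 2 → ℝ),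
    (∀ l, 0 ≤ q l) ∧ (∑ l, q l) = 1 ∧
    (∀ l o1 i1, 0 ≤ p1 l o1 i1) ∧ (∀ l i1, (∑ o1, p1 l o1 i1) = 1) ∧
    (∀ l o2 o3 i2 i3, 0 ≤ p23 l o2 o3 i2 i3) ∧
    (∀ l i2 i3, (∑ o2, ∑ o3, p23 l o2 o3 i2 i3) = 1) ∧
    (∀ l o2 i2 i3 i3', (∑ o3, p23 l o2 o3 i2 i3) = ∑ o3, p23 l o2 o3 i2 i3') ∧
    (∀ o1 o2 o3 i1 i2 i3,
      p o1 o2 o3 i1 i2 i3 = ∑ l, q l * p1 l o1 i1 * p23 l o2 o3 i2 i3)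

/-- The Gallego et al. GHZ correlation `P^G`. -/
noncomputable def pG : TriCorr := fun o1 o2 o3 i1 i2 i3 =>
  (1 / 8) * (1
    + (-1 : ℝ) ^ (o1.val + o2.val) * (if i1 = 0 then 1 else 0) * (if i2 = 0 then 1 else 0)
    + (1 / Real.sqrt 2) * (-1 : ℝ) ^ (o1.val + o3.val) * (if i1 = 0 then 1 else 0)
    + (1 / Real.sqrt 2) * (-1 : ℝ) ^ (o2.val + o3.val) * (if i2 = 0 then 1 else 0)
    + (1 / Real.sqrt 2) * (-1 : ℝ) ^ (i3.val + o1.val + o2.val + o3.val)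
        * (if i1 = 1 then 1 else 0) * (if i2 = 1 then 1 else 0))

/-- A 2←3 time-ordered bilocal model may be indexed by any finite type. -/
theorem ATOBL_left.of_fintype {ι : Type*} [Fintype ι] {p : TriCorr} (q : ι → ℝ)
    (p1 : ι → Fin 2 → Fin 2 → ℝ) (p23 : ι → Fin 2 → Fin 2 → Fin 2 → Fin 2 → ℝ)
    (hq : ∀ l, 0 ≤ q l) (hq1 : (∑ l, q l) = 1)
    (hp1 : ∀ l o1 i1, 0 ≤ p1 l o1 i1) (hp1s : ∀ l i1, (∑ o1, p1 l o1 i1) = 1)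
    (hp23 : ∀ l o2 o3 i2 i3, 0 ≤ p23 l o2 o3 i2 i3)
    (hp23s : ∀ l i2 i3, (∑ o2, ∑ o3, p23 l o2 o3 i2 i3) = 1)
    (hns : ∀ l o3 i2 i2' i3, (∑ o2, p23 l o2 o3 i2 i3) = ∑ o2, p23 l o2 o3 i2' i3)
    (hp : ∀ o1 o2 o3 i1 i2 i3,
      p o1 o2 o3 i1 i2 i3 = ∑ l, q l * p1 l o1 i1 * p23 l o2 o3 i2 i3) :
    ATOBL_left p := by
  let e := (Fintype.equivFin ι).symm
  refine ⟨Fintype.card ι, fun l => q (e l), fun l => p1 (e l), fun l => p23 (e l),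
    fun l => hq _, (e.sum_comp q).trans hq1, fun l => hp1 _, fun l => hp1s _,
    fun l => hp23 _, fun l => hp23s _, fun l => hns _, fun o1 o2 o3 i1 i2 i3 => ?_⟩
  rw [hp]
  exact (e.sum_comp fun l => q l * p1 l o1 i1 * p23 l o2 o3 i2 i3).symm

/-- The distribution of party 3's output: biased by `1 / √2` towards the shared bit `a`. -/
noncomputable def biasedBit (a o : Fin 2) : ℝ :=
  (1 + 1 / Real.sqrt 2 * (-1 : ℝ) ^ (a.val + o.val)) / 2

theorem biasedBit_nonneg (a o : Fin 2) : 0 ≤ biasedBit a o := by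
  have h0 : 0 ≤ 1 / Real.sqrt 2 := by positivity
  have h1 : 1 / Real.sqrt 2 ≤ 1 :=
    div_le_one_of_le₀ (Real.one_le_sqrt.2 one_le_two) (Real.sqrt_nonneg 2)
  unfold biasedBit
  rcases neg_one_pow_eq_or ℝ (a.val + o.val) with h | h <;> rw [h] <;> linarith

theorem sum_biasedBit (a : Fin 2) : ∑ o, biasedBit a o = 1 := by
  simp only [biasedBit, Fin.sum_univ_two, Fin.val_zero, Fin.val_one, pow_add]
  ring

/-- Party 2's output: the shared bit `a` on input `0`, and `a + b + i₃` on input `1`. -/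
def responseBit (a b i2 i3 : Fin 2) : Fin 2 :=
  if i2 = 0 then a else a + b + i3

/-- `pG` is a uniform mixture over two shared bits `(a₀, a₁)`: party 1 outputs the bit selected by
its input, party 3 outputs a bit biased towards `a₀`, and party 2 outputs `responseBit`. -/
theorem pG_eq_sum (o1 o2 o3 i1 i2 i3 : Fin 2) :
    pG o1 o2 o3 i1 i2 i3 = ∑ l : Fin 2 × Fin 2, (1 / 4 : ℝ) *
      (if o1 = (if i1 = 0 then l.1 else l.2) then 1 else 0) *
      ((if o2 = responseBit l.1 l.2 i2 i3 then 1 else 0) * biasedBit l.1 o3) := by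
  fin_cases o1 <;> fin_cases o2 <;> fin_cases i1 <;> fin_cases i2 <;> fin_cases i3 <;>
    simp [pG, responseBit, biasedBit, Fintype.sum_prod_type, pow_add] <;> ring

/-- `P^G` admits a 2←3 time-ordered bilocal decomposition across 1|23. -/
theorem pG_mem_ATOBL_left : ATOBL_left pG := by
  refine ATOBL_left.of_fintype (ι := Fin 2 × Fin 2) (fun _ => 1 / 4)
    (fun l o1 i1 => if o1 = (if i1 = 0 then l.1 else l.2) then 1 else 0)
    (fun l o2 o3 i2 i3 => (if o2 = responseBit l.1 l.2 i2 i3 then 1 else 0) * biasedBit l.1 o3)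
    (fun _ => by norm_num) (by simp) ?_ ?_ ?_ ?_ ?_ pG_eq_sum
  · intro l o1 i1
    positivity
  · simp
  · intro l o2 o3 i2 i3
    exact mul_nonneg (by positivity) (biasedBit_nonneg _ _)
  · intro l i2 i3
    simp only [← Finset.mul_sum, sum_biasedBit]
    simp
  · simp
end

section
/- If a tripartite binary correlation p belongs to ATOBL_{2←3}, then its 3→2 wiring Q'(o₁o₂|i₁i₃) := Σ_{o₃} p(o₁o₂o₃|i₁, i₂=o₃, i₃) is a local bipartite correlation. -/
open scoped BigOperators

/-- A bipartite binary correlation `Q a b x y` is local: it admits an LHV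
decomposition with a finite hidden variable. -/
def IsLocal (Q : Fin 2 → Fin 2 → Fin 2 → Fin 2 → ℝ) : Prop :=
  ∃ (n : ℕ) (q : Fin n → ℝ) (q1 q2 : Fin n → Fin 2 → Fin 2 → ℝ),
    (∀ l, 0 ≤ q l) ∧ (∑ l, q l) = 1 ∧
    (∀ l a x, 0 ≤ q1 l a x) ∧ (∀ l x, (∑ a, q1 l a x) = 1) ∧
    (∀ l b y, 0 ≤ q2 l b y) ∧ (∀ l y, (∑ b, q2 l b y) = 1) ∧
    (∀ a b x y, Q a b x y = ∑ l, q l * q1 l a x * q2 l b y)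

/-- If `p ∈ ATOBL_{2←3}` then its 3→2 wiring
`Q'(o₁o₂|i₁i₃) = Σ_{o₃} p(o₁o₂o₃|i₁, i₂=o₃, i₃)` is local. -/
theorem wiring32_of_ATOBL_left_isLocal (p : TriCorr) (hp : IsTriCorr p)
    (h : ATOBL_left p) :
    IsLocal (fun o1 o2 i1 i3 => ∑ o3, p o1 o2 o3 i1 o3 i3) := by
  obtain ⟨n, q, p1, p23, hq, hqs, hp1, hp1s, hp23, hp23s, hns, hdec⟩ := h
  refine ⟨n, q, p1, fun l o2 i3 => ∑ o3, p23 l o2 o3 o3 i3, hq, hqs, hp1, hp1s,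
    fun l o2 i3 => Finset.sum_nonneg fun o3 _ => hp23 l o2 o3 o3 i3, fun l i3 => ?_,
    fun o1 o2 i1 i3 => ?_⟩
  · calc ∑ o2, ∑ o3, p23 l o2 o3 o3 i3
        = ∑ o3, ∑ o2, p23 l o2 o3 o3 i3 := Finset.sum_comm
      _ = ∑ o3, ∑ o2, p23 l o2 o3 0 i3 :=
          Finset.sum_congr rfl fun o3 _ => hns l o3 o3 0 i3
      _ = ∑ o2, ∑ o3, p23 l o2 o3 0 i3 := Finset.sum_comm
      _ = 1 := hp23s l 0 i3
  · simp only [hdec, Finset.mul_sum]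
    exact Finset.sum_comm
end

section
/- If a tripartite binary correlation p belongs to ATOBL_{2→3}, then its 2→3 wiring Q(o₁o₃|i₁i₂) := Σ_{o₂} p(o₁o₂o₃|i₁, i₂, i₃=o₂) is a local bipartite correlation. -/
open scoped BigOperators

/-- If `p ∈ ATOBL_{2→3}` then its 2→3 wiring
`Q(o₁o₃|i₁i₂) = Σ_{o₂} p(o₁o₂o₃|i₁, i₂, i₃=o₂)` is local. -/
theorem wiring23_of_ATOBL_right_isLocal (p : TriCorr) (hp : IsTriCorr p)
    (h : ATOBL_right p) :
    IsLocal (fun o1 o3 i1 i2 => ∑ o2, p o1 o2 o3 i1 i2 o2) := by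
  obtain ⟨n, q, p1, p23, hq, hq1, hp1, hp1n, hp23, hp23n, hns, hdec⟩ := h
  refine ⟨n, q, p1, fun l o3 i2 => ∑ o2, p23 l o2 o3 i2 o2, hq, hq1, hp1, hp1n,
    fun l o3 i2 => Finset.sum_nonneg fun o2 _ => hp23 l o2 o3 i2 o2, fun l i2 => ?_,
    fun o1 o3 i1 i2 => ?_⟩
  · rw [Finset.sum_comm, ← hp23n l i2 0]
    exact Finset.sum_congr rfl fun o2 _ => hns l o2 i2 o2 0
  · simp only [hdec, Finset.mul_sum]
    exact Finset.sum_comm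
end

section
/- The 2→3 wiring of P^G, i.e. the bipartite binary correlation Q(o₁o₃|i₁i₂) := Σ_{o₂} p^G(o₁o₂o₃|i₁, i₂, i₃=o₂), is not local: it admits no decomposition Q(ab|xy) = Σ_λ q(λ)·q₁(a|x,λ)·q₂(b|y,λ) with a finite set Λ, weights q(λ) ≥ 0 summing to 1, and nonnegative output-normalized distributions q₁, q₂. -/
open scoped BigOperators

/-- The correlator `∑ (-1)^(a+b) Q(a b | x y)` of a bipartite binary correlation. -/
def correlator (Q : Fin 2 → Fin 2 → Fin 2 → Fin 2 → ℝ) (x y : Fin 2) : ℝ :=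
  Q 0 0 x y - Q 0 1 x y - Q 1 0 x y + Q 1 1 x y

lemma chsh_le_two_of_abs_le_one {a₀ a₁ b₀ b₁ : ℝ} (ha₀ : |a₀| ≤ 1) (ha₁ : |a₁| ≤ 1)
    (hb₀ : |b₀| ≤ 1) (hb₁ : |b₁| ≤ 1) :
    a₀ * b₀ + a₀ * b₁ - a₁ * b₀ + a₁ * b₁ ≤ 2 := by
  rw [abs_le] at *
  have h₀ : a₀ * (b₀ + b₁) ≤ |b₀ + b₁| := by
    cases abs_cases (b₀ + b₁) <;> nlinarith
  have h₁ : a₁ * (b₁ - b₀) ≤ |b₁ - b₀| := by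
    cases abs_cases (b₁ - b₀) <;> nlinarith
  have h : |b₀ + b₁| + |b₁ - b₀| ≤ 2 := by
    cases abs_cases (b₀ + b₁) <;> cases abs_cases (b₁ - b₀) <;> linarith
  linarith

lemma abs_sub_le_one_of_sum_eq_one {p : Fin 2 → ℝ} (hp : ∀ a, 0 ≤ p a) (hsum : ∑ a, p a = 1) :
    |p 0 - p 1| ≤ 1 := by
  rw [Fin.sum_univ_two] at hsum
  rw [abs_le]
  constructor <;> linarith [hp 0, hp 1]

/-- The CHSH inequality for local correlations. -/
theorem IsLocal.chsh {Q : Fin 2 → Fin 2 → Fin 2 → Fin 2 → ℝ} (hQ : IsLocal Q) :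
    correlator Q 0 0 + correlator Q 0 1 - correlator Q 1 0 + correlator Q 1 1 ≤ 2 := by
  obtain ⟨n, q, q1, q2, hq, hqsum, hq1, hq1sum, hq2, hq2sum, hdecomp⟩ := hQ
  have hcorr (x y : Fin 2) : correlator Q x y =
      ∑ l, q l * ((q1 l 0 x - q1 l 1 x) * (q2 l 0 y - q2 l 1 y)) := by
    simp only [correlator, hdecomp, ← Finset.sum_sub_distrib, ← Finset.sum_add_distrib]
    exact Finset.sum_congr rfl fun l _ => by ring
  have hA (l : Fin n) (x : Fin 2) : |q1 l 0 x - q1 l 1 x| ≤ 1 :=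
    abs_sub_le_one_of_sum_eq_one (p := fun a => q1 l a x) (fun a => hq1 l a x) (hq1sum l x)
  have hB (l : Fin n) (y : Fin 2) : |q2 l 0 y - q2 l 1 y| ≤ 1 :=
    abs_sub_le_one_of_sum_eq_one (p := fun b => q2 l b y) (fun b => hq2 l b y) (hq2sum l y)
  simp only [hcorr, ← Finset.sum_sub_distrib, ← Finset.sum_add_distrib]
  calc _ ≤ ∑ l, q l * 2 := Finset.sum_le_sum fun l _ => by
        linear_combination mul_le_mul_of_nonneg_left
          (chsh_le_two_of_abs_le_one (hA l 0) (hA l 1) (hB l 0) (hB l 1)) (hq l)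
    _ = 2 := by rw [← Finset.sum_mul, hqsum, one_mul]

lemma correlator_pG_wiring (x y : Fin 2) :
    correlator (fun o1 o3 i1 i2 => ∑ o2, pG o1 o2 o3 i1 i2 o2) x y =
      if x = 1 ∧ y = 0 then 0 else 1 / Real.sqrt 2 := by
  fin_cases x <;> fin_cases y <;> simp [correlator, pG, Fin.sum_univ_two] <;> ring

/-- The 2→3 wiring of `P^G` is not a local bipartite correlation. -/
theorem pG_wiring_not_local :
    ¬ IsLocal (fun o1 o3 i1 i2 => ∑ o2, pG o1 o2 o3 i1 i2 o2) := by
  intro hlocal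
  have hchsh := hlocal.chsh
  simp only [correlator_pG_wiring] at hchsh
  norm_num at hchsh
  have hsqrt : Real.sqrt 2 < 3 / 2 := by
    rw [Real.sqrt_lt' (by norm_num)]
    norm_num
  have hinv : 2 / 3 < (Real.sqrt 2)⁻¹ := by
    rw [lt_inv_comm₀ (by norm_num) (by positivity)]
    norm_num [hsqrt]
  linarith
end

section
/- Define the party-swapped correlation P^G_swap by P^G_swap(o₁o₂o₃|i₁i₂i₃) := p^G(o₁o₃o₂|i₁i₃i₂). Then P^G_swap ∈ ATOBL_{2→3} but P^G_swap ∉ ATOBL_{2←3}; consequently the set TOBL := ATOBL_{2←3} ∩ ATOBL_{2→3} is a strict subset of ATOBL_{2→3}. -/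
open scoped BigOperators

/-- The party-swapped correlation `P^G_swap(o₁o₂o₃|i₁i₂i₃) := p^G(o₁o₃o₂|i₁i₃i₂)`. -/
noncomputable def pGswap : TriCorr := fun o1 o2 o3 i1 i2 i3 => pG o1 o3 o2 i1 i3 i2

/-- The sign `±1` of a binary output. -/
def outcomeSign (o : Fin 2) : ℝ := (-1 : ℝ) ^ o.val

/-- The CHSH-type functional `⟨A₀B₀⟩ + ⟨A₀B₁⟩ + ⟨A₁B₀C⟩ - ⟨A₁B₁C⟩`, evaluated at `i₃ = 1`. -/
noncomputable def chshFunctional (p : TriCorr) : ℝ :=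
  ∑ o1, ∑ o2, ∑ o3, outcomeSign o1 * outcomeSign o2 *
    (p o1 o2 o3 0 0 1 + p o1 o2 o3 0 1 1 +
      outcomeSign o3 * (p o1 o2 o3 1 0 1 - p o1 o2 o3 1 1 1))

lemma mul_add_add_mul_sub_le_two_mul {a a' b b' m : ℝ} (ha : |a| ≤ 1) (ha' : |a'| ≤ 1)
    (hb : |b| ≤ m) (hb' : |b'| ≤ m) : a * (b + b') + a' * (b - b') ≤ 2 * m := by
  have bound : ∀ {x y : ℝ}, |x| ≤ 1 → x * y ≤ |y| := fun {x y} hx =>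
    (le_abs_self _).trans (by
      rw [abs_mul]; exact mul_le_of_le_one_left (abs_nonneg y) hx)
  refine (add_le_add (bound ha) (bound ha')).trans ?_
  rw [abs_le] at hb hb'
  rcases abs_cases (b + b') with h | h <;> rcases abs_cases (b - b') with h' | h' <;> linarith

/-- The CHSH bound for a product term whose bipartite part is no-signaling from party 2 to
party 3. -/
lemma chshFunctional_product_le_two (p1 : Fin 2 → Fin 2 → ℝ)
    (p23 : Fin 2 → Fin 2 → Fin 2 → Fin 2 → ℝ)
    (h1 : ∀ o i, 0 ≤ p1 o i) (h1s : ∀ i, ∑ o, p1 o i = 1)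
    (h23 : ∀ o2 o3 i2 i3, 0 ≤ p23 o2 o3 i2 i3)
    (h23s : ∀ i2 i3, ∑ o2, ∑ o3, p23 o2 o3 i2 i3 = 1)
    (hns : ∀ o3 i2 i2' i3, ∑ o2, p23 o2 o3 i2 i3 = ∑ o2, p23 o2 o3 i2' i3) :
    chshFunctional (fun o1 o2 o3 i1 i2 i3 => p1 o1 i1 * p23 o2 o3 i2 i3) ≤ 2 := by
  simp only [Fin.sum_univ_two] at h1s h23s hns
  have hA : ∀ i, |p1 0 i - p1 1 i| ≤ 1 := fun i => by
    rw [abs_le]; constructor <;> linarith [h1 0 i, h1 1 i, h1s i]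
  have hB : ∀ c y, |p23 0 c y 1 - p23 1 c y 1| ≤ p23 0 c 0 1 + p23 1 c 0 1 := fun c y => by
    rw [abs_le]; constructor <;> linarith [h23 0 c y 1, h23 1 c y 1, hns c y 0 1]
  have hC0 := mul_add_add_mul_sub_le_two_mul (hA 0) (hA 1) (hB 0 0) (hB 0 1)
  have hC1 := mul_add_add_mul_sub_le_two_mul (hA 0) ((abs_neg _).trans_le (hA 1))
    (hB 1 0) (hB 1 1)
  simp only [chshFunctional, outcomeSign, Fin.sum_univ_two, Fin.val_zero, Fin.val_one, pow_zero,
    pow_one]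
  linarith [h23s 0 1]

lemma chshFunctional_sum {n : ℕ} (q : Fin n → ℝ) (P : Fin n → TriCorr) :
    chshFunctional (fun o1 o2 o3 i1 i2 i3 => ∑ l, q l * P l o1 o2 o3 i1 i2 i3) =
      ∑ l, q l * chshFunctional (P l) := by
  simp only [chshFunctional, Fin.sum_univ_two, ← Finset.sum_add_distrib,
    ← Finset.sum_sub_distrib, Finset.mul_sum]
  exact Finset.sum_congr rfl fun l _ => by ring

lemma ATOBL_left.chshFunctional_le_two {p : TriCorr} (hp : ATOBL_left p) :
    chshFunctional p ≤ 2 := by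
  obtain ⟨n, q, p1, p23, hq, hqs, h1, h1s, h23, h23s, hns, hdec⟩ := hp
  have hp_eq : p = fun o1 o2 o3 i1 i2 i3 =>
      ∑ l, q l * (p1 l o1 i1 * p23 l o2 o3 i2 i3) := by
    funext o1 o2 o3 i1 i2 i3
    simp only [hdec, mul_assoc]
  rw [hp_eq, chshFunctional_sum q (fun l o1 o2 o3 i1 i2 i3 => p1 l o1 i1 * p23 l o2 o3 i2 i3)]
  calc ∑ l, q l * chshFunctional (fun o1 o2 o3 i1 i2 i3 => p1 l o1 i1 * p23 l o2 o3 i2 i3)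
      ≤ ∑ l, q l * 2 := Finset.sum_le_sum fun l _ => mul_le_mul_of_nonneg_left
        (chshFunctional_product_le_two _ _ (h1 l) (h1s l) (h23 l) (h23s l) (hns l)) (hq l)
    _ = 2 := by rw [← Finset.sum_mul, hqs, one_mul]

lemma chshFunctional_pGswap : chshFunctional pGswap = 4 * (1 / √2) := by
  simp [chshFunctional, pGswap, pG, outcomeSign, Fin.sum_univ_two]
  ring

lemma not_ATOBL_left_pGswap : ¬ ATOBL_left pGswap := fun h => by
  have hle := h.chshFunctional_le_two
  rw [chshFunctional_pGswap] at hle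
  have hpos : (0 : ℝ) < √2 := by positivity
  have hsq : √2 * √2 = 2 := Real.mul_self_sqrt (by norm_num)
  rw [mul_one_div, div_le_iff₀ hpos] at hle
  nlinarith

/-- Party 1's predetermined output: the hidden state `l` encodes the two outputs as bits. -/
def hiddenOutput (l : Fin 4) (i : Fin 2) : Fin 2 :=
  if i = 0 then ![0, 0, 1, 1] l else ![0, 1, 0, 1] l

/-- Party 2 outputs `o₂`, biased by `s` towards party 1's output for `i₁ = 0`; party 3 knows
`o₂` and `i₂`, and reproduces party 1's output for `i₁ = 0` when `i₃ = 0`, while it is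
biased by `s` towards `i₂ + o₁ + o₂ + o₃ = 0` for `i₁ = 1` when `i₃ = 1`. -/
noncomputable def biasedResponse (s : ℝ) (l : Fin 4) (o2 o3 i2 i3 : Fin 2) : ℝ :=
  (1 + s * outcomeSign (hiddenOutput l 0) * outcomeSign o2) / 2 *
    if i3 = 0 then (if o3 = hiddenOutput l 0 then 1 else 0)
    else (1 + s * outcomeSign (hiddenOutput l 1) * outcomeSign o2 * outcomeSign i2 *
      outcomeSign o3) / 2

lemma abs_outcomeSign (o : Fin 2) : |outcomeSign o| = 1 := by
  simp [outcomeSign]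

lemma biasedResponse_nonneg {s : ℝ} (hs : |s| ≤ 1) (l : Fin 4) (o2 o3 i2 i3 : Fin 2) :
    0 ≤ biasedResponse s l o2 o3 i2 i3 := by
  have nonneg : ∀ {x : ℝ}, |x| ≤ 1 → 0 ≤ (1 + x) / 2 := fun hx => by
    linarith [(abs_le.mp hx).1]
  refine mul_nonneg (nonneg (by simpa [abs_mul, abs_outcomeSign] using hs)) ?_
  split_ifs
  · exact zero_le_one
  · exact le_rfl
  · exact nonneg (by simpa [abs_mul, abs_outcomeSign] using hs)

lemma sum_biasedResponse (s : ℝ) (l : Fin 4) (o2 i2 i3 : Fin 2) :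
    ∑ o3, biasedResponse s l o2 o3 i2 i3 =
      (1 + s * outcomeSign (hiddenOutput l 0) * outcomeSign o2) / 2 := by
  simp only [biasedResponse, ← Finset.mul_sum]
  refine (congrArg _ ?_).trans (mul_one _)
  split_ifs
  · simp
  · simp only [Fin.sum_univ_two, outcomeSign, Fin.val_zero, Fin.val_one, pow_zero, pow_one]
    ring

lemma pGswap_eq_sum (o1 o2 o3 i1 i2 i3 : Fin 2) :
    pGswap o1 o2 o3 i1 i2 i3 = ∑ l : Fin 4, 1 / 4 * (if o1 = hiddenOutput l i1 then 1 else 0) *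
      biasedResponse (1 / √2) l o2 o3 i2 i3 := by
  simp only [pGswap, pG, biasedResponse, hiddenOutput, outcomeSign, Fin.sum_univ_four]
  generalize (1 / √2 : ℝ) = s
  fin_cases i1 <;> fin_cases i3 <;> fin_cases o1 <;> fin_cases o3 <;>
    fin_cases o2 <;> fin_cases i2 <;> simp <;> ring_nf

lemma ATOBL_right_pGswap : ATOBL_right pGswap := by
  have hs : |(1 / √2 : ℝ)| ≤ 1 := by
    rw [abs_of_nonneg (by positivity)]
    exact div_le_one_of_le₀ (Real.one_le_sqrt.mpr one_le_two) (Real.sqrt_nonneg 2)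
  refine ⟨4, fun _ => 1 / 4, fun l o1 i1 => if o1 = hiddenOutput l i1 then 1 else 0,
    biasedResponse (1 / √2), fun _ => by norm_num, by norm_num, fun l o1 i1 => ?_, by simp,
    biasedResponse_nonneg hs, fun l i2 i3 => ?_, fun l o2 i2 i3 i3' => ?_, pGswap_eq_sum⟩
  · dsimp only
    split_ifs <;> norm_num
  · simp only [sum_biasedResponse]
    simp only [Fin.sum_univ_two, outcomeSign, Fin.val_zero, Fin.val_one, pow_zero, pow_one]
    ring
  · simp only [sum_biasedResponse]

/-- `P^G_swap ∈ ATOBL_{2→3}` but `P^G_swap ∉ ATOBL_{2←3}`; hence TOBL is a strict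
subset of `ATOBL_{2→3}`. -/
theorem pGswap_witnesses_TOBL_ssubset_ATOBL_right :
    ATOBL_right pGswap ∧ ¬ ATOBL_left pGswap ∧
    {p : TriCorr | ATOBL_left p ∧ ATOBL_right p} ⊂ {p : TriCorr | ATOBL_right p} :=
  ⟨ATOBL_right_pGswap, not_ATOBL_left_pGswap, fun _ hp => hp.2,
    fun h => not_ATOBL_left_pGswap (h ATOBL_right_pGswap).1⟩
end

section
/- For every ε ∈ [0,1], the correlation P^ε_{2←3} belongs to ATOBL_{2←3}. -/
open scoped BigOperators

/-- The correlation `P^ε_{2←3}` of Dutta–Mukherjee–Banik. -/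
noncomputable def pEpsL (ε : ℝ) : TriCorr := fun o1 o2 o3 i1 i2 i3 =>
  (1 / 8) * (1
    + (-1 : ℝ) ^ (o1.val + o2.val) * (if i1 = 0 then 1 else 0) * (if i2 = 0 then 1 else 0)
    + ε * (-1 : ℝ) ^ (o1.val + o3.val) * (if i1 = 0 then 1 else 0)
    + ε * (-1 : ℝ) ^ (o2.val + o3.val) * (if i2 = 0 then 1 else 0)
    + ε * (-1 : ℝ) ^ (i3.val + o1.val + o2.val + o3.val)
        * (if i1 = 1 then 1 else 0) * (if i2 = 1 then 1 else 0))

/-- The correlation `P^ε_{2→3}`, obtained from `P^ε_{2←3}` by swapping parties 2 and 3. -/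
noncomputable def pEpsR (ε : ℝ) : TriCorr := fun o1 o2 o3 i1 i2 i3 =>
  pEpsL ε o1 o3 o2 i1 i3 i2

/-- The sign `(-1) ^ a` attached to a bit `a`. -/
def bitSign (a : Fin 2) : ℝ := if a = 0 then 1 else -1

/-- The first hidden bit of party 1, its output on input `0`, as a sign. -/
def hiddenSignZero : Fin 4 → ℝ := ![1, 1, -1, -1]

/-- The second hidden bit of party 1, its output on input `1`, as a sign. -/
def hiddenSignOne : Fin 4 → ℝ := ![1, -1, 1, -1]

/-- Party 1 deterministically outputs the hidden bit selected by its input. -/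
noncomputable def responseOne (l : Fin 4) (o1 i1 : Fin 2) : ℝ :=
  1 / 2 * (1 + (if i1 = 0 then hiddenSignZero l else hiddenSignOne l) * bitSign o1)

/-- Party 3 outputs the first hidden bit with bias `ε`; party 2 outputs the first hidden bit on
input `0`, and the sum of both hidden bits and the input of party 3 on input `1`. -/
noncomputable def responseTwoThree (ε : ℝ) (l : Fin 4) (o2 o3 i2 i3 : Fin 2) : ℝ :=
  1 / 4 * ((1 + (if i2 = 0 then hiddenSignZero l
      else hiddenSignZero l * hiddenSignOne l * bitSign i3) * bitSign o2)
    * (1 + ε * hiddenSignZero l * bitSign o3))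

/-- For every `ε ∈ [0,1]`, `P^ε_{2←3} ∈ ATOBL_{2←3}`. -/
theorem pEpsL_mem_ATOBL_left (ε : ℝ) (hε : ε ∈ Set.Icc (0 : ℝ) 1) :
    ATOBL_left (pEpsL ε) := by
  obtain ⟨h0, h1⟩ := hε
  refine ⟨4, fun _ => 1 / 4, responseOne, responseTwoThree ε, fun _ => by norm_num, by norm_num,
    ?_, ?_, ?_, ?_, ?_, ?_⟩
  · intro l o1 i1
    fin_cases l <;> fin_cases o1 <;> fin_cases i1 <;>
      norm_num [responseOne, hiddenSignZero, hiddenSignOne, bitSign]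
  · intro l i1
    simp [responseOne, bitSign, Fin.sum_univ_two]
    ring
  · intro l o2 o3 i2 i3
    refine mul_nonneg (by norm_num) (mul_nonneg ?_ ?_)
    · fin_cases l <;> fin_cases o2 <;> fin_cases i2 <;> fin_cases i3 <;>
        norm_num [hiddenSignZero, hiddenSignOne, bitSign]
    · fin_cases l <;> fin_cases o3 <;> simp [hiddenSignZero, bitSign] <;> linarith
  · intro l i2 i3
    simp [responseTwoThree, bitSign, Fin.sum_univ_two]
    ring
  · intro l o3 i2 i2' i3
    simp [responseTwoThree, bitSign, Fin.sum_univ_two]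
    ring
  · intro o1 o2 o3 i1 i2 i3
    fin_cases o1 <;> fin_cases o2 <;> fin_cases o3 <;> fin_cases i1 <;> fin_cases i2 <;>
      fin_cases i3 <;>
      simp [pEpsL, responseOne, responseTwoThree, hiddenSignZero, hiddenSignOne, bitSign,
        Fin.sum_univ_four] <;> ring
end

section
/- For all ε, α ∈ [0,1], let Q be the 2→3 wiring of P^ε_α, i.e. Q(o₁o₃|i₁i₂) := Σ_{o₂} P^ε_α(o₁o₂o₃|i₁, i₂, i₃=o₂). Then its correlators E(x,y) := Σ_{a,b} (−1)^{a+b} Q(ab|xy) satisfy E(0,0) + E(0,1) − E(1,0) + E(1,1) = (1−α) + ε(1+2α). -/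
open scoped BigOperators

/-- The convex mixture `P^ε_α = α P^ε_{2←3} + (1-α) P^ε_{2→3}`. -/
noncomputable def pEpsAlpha (ε α : ℝ) : TriCorr := fun o1 o2 o3 i1 i2 i3 =>
  α * pEpsL ε o1 o2 o3 i1 i2 i3 + (1 - α) * pEpsR ε o1 o2 o3 i1 i2 i3

/-- The CHSH value of the 2→3 wiring of `P^ε_α` is `(1-α) + ε(1+2α)`. -/
theorem pEpsAlpha_wiring23_CHSH (ε α : ℝ)
    (hε : ε ∈ Set.Icc (0 : ℝ) 1) (hα : α ∈ Set.Icc (0 : ℝ) 1) :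
    let Q : Fin 2 → Fin 2 → Fin 2 → Fin 2 → ℝ :=
      fun o1 o3 i1 i2 => ∑ o2, pEpsAlpha ε α o1 o2 o3 i1 i2 o2
    let E : Fin 2 → Fin 2 → ℝ :=
      fun x y => ∑ a, ∑ b, (-1 : ℝ) ^ (a.val + b.val) * Q a b x y
    E 0 0 + E 0 1 - E 1 0 + E 1 1 = (1 - α) + ε * (1 + 2 * α) := by
  simp [Fin.sum_univ_two, pEpsAlpha, pEpsR, pEpsL]
  ring
end

section
/- For all ε, α ∈ [0,1], let Q' be the 3→2 wiring of P^ε_α, i.e. Q'(o₁o₂|i₁i₃) := Σ_{o₃} P^ε_α(o₁o₂o₃|i₁, i₂=o₃, i₃). Then its correlators E(x,y) := Σ_{a,b} (−1)^{a+b} Q'(ab|xy) satisfy E(0,0) + E(0,1) − E(1,0) + E(1,1) = α + ε(3−2α). -/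
open scoped BigOperators

/-- The CHSH value of the 3→2 wiring of `P^ε_α` is `α + ε(3-2α)`. -/
theorem pEpsAlpha_wiring32_CHSH (ε α : ℝ)
    (hε : ε ∈ Set.Icc (0 : ℝ) 1) (hα : α ∈ Set.Icc (0 : ℝ) 1) :
    let Q' : Fin 2 → Fin 2 → Fin 2 → Fin 2 → ℝ :=
      fun o1 o2 i1 i3 => ∑ o3, pEpsAlpha ε α o1 o2 o3 i1 o3 i3
    let E : Fin 2 → Fin 2 → ℝ :=
      fun x y => ∑ a, ∑ b, (-1 : ℝ) ^ (a.val + b.val) * Q' a b x y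
    E 0 0 + E 0 1 - E 1 0 + E 1 1 = α + ε * (3 - 2 * α) := by
  simp only [pEpsAlpha, pEpsR, pEpsL, Fin.sum_univ_two]
  norm_num
  ring
end

section
/- For every ε ∈ (3/4, 1], the correlation P^ε_{1/2} belongs neither to ATOBL_{2←3} nor to ATOBL_{2→3}. -/
open scoped BigOperators

/-- The expectation of `(-1) ^ (o1 + o2)` under inputs `(i1, i2, i3)`. -/
noncomputable def corr12 (p : TriCorr) (i1 i2 i3 : Fin 2) : ℝ :=
  ∑ o1, ∑ o2, ∑ o3, (-1 : ℝ) ^ (o1.val + o2.val) * p o1 o2 o3 i1 i2 i3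

/-- The expectation of `(-1) ^ (o1 + o2 + o3)` under inputs `(i1, i2, i3)`. -/
noncomputable def corr123 (p : TriCorr) (i1 i2 i3 : Fin 2) : ℝ :=
  ∑ o1, ∑ o2, ∑ o3, (-1 : ℝ) ^ (o1.val + o2.val + o3.val) * p o1 o2 o3 i1 i2 i3

/-- A CHSH functional between party 2 and the joint parties 1 and 3, with `i3 = 1` throughout. -/
noncomputable def chshTwo (p : TriCorr) : ℝ :=
  corr12 p 0 0 1 + corr12 p 0 1 1 + corr123 p 1 0 1 - corr123 p 1 1 1

lemma mul_add_add_mul_sub_le_two_mul_s15 {u v d e r : ℝ} (hu : |u| ≤ 1) (hv : |v| ≤ 1)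
    (hd : |d| ≤ r) (he : |e| ≤ r) : u * (d + e) + v * (d - e) ≤ 2 * r := by
  have key : ∀ {w x : ℝ}, |w| ≤ 1 → w * x ≤ |x| := fun {w x} hw =>
    (le_abs_self _).trans (by rw [abs_mul]; exact mul_le_of_le_one_left (abs_nonneg x) hw)
  have hsum : |d + e| + |d - e| ≤ 2 * r := by
    rw [abs_le] at hd he
    rcases abs_cases (d + e) with h | h <;> rcases abs_cases (d - e) with h' | h' <;> linarith
  linarith [key (x := d + e) hu, key (x := d - e) hv]

lemma abs_sub_le_add_of_nonneg {x y : ℝ} (hx : 0 ≤ x) (hy : 0 ≤ y) : |x - y| ≤ x + y :=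
  abs_le.2 ⟨by linarith, by linarith⟩

lemma chshTwo_bilocal_le_two {p1 : Fin 2 → Fin 2 → ℝ} {p23 : Fin 2 → Fin 2 → Fin 2 → Fin 2 → ℝ}
    (h1 : ∀ o1 i1, 0 ≤ p1 o1 i1) (h1s : ∀ i1, ∑ o1, p1 o1 i1 = 1)
    (h23 : ∀ o2 o3 i2 i3, 0 ≤ p23 o2 o3 i2 i3)
    (h23s : ∀ i2 i3, ∑ o2, ∑ o3, p23 o2 o3 i2 i3 = 1)
    (hns : ∀ o3 i2 i2' i3, ∑ o2, p23 o2 o3 i2 i3 = ∑ o2, p23 o2 o3 i2' i3) :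
    chshTwo (fun o1 o2 o3 i1 i2 i3 => p1 o1 i1 * p23 o2 o3 i2 i3) ≤ 2 := by
  simp only [Fin.sum_univ_two] at h1s h23s hns
  have hp (i : Fin 2) : |p1 0 i - p1 1 i| ≤ 1 :=
    (abs_sub_le_add_of_nonneg (h1 0 i) (h1 1 i)).trans_eq (h1s i)
  have hd (o : Fin 2) : |p23 0 o 0 1 - p23 1 o 0 1| ≤ p23 0 o 0 1 + p23 1 o 0 1 :=
    abs_sub_le_add_of_nonneg (h23 _ _ _ _) (h23 _ _ _ _)
  have he (o : Fin 2) : |p23 0 o 1 1 - p23 1 o 1 1| ≤ p23 0 o 0 1 + p23 1 o 0 1 :=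
    (abs_sub_le_add_of_nonneg (h23 _ _ _ _) (h23 _ _ _ _)).trans_eq (hns o 1 0 1)
  have b0 := mul_add_add_mul_sub_le_two_mul_s15 (hp 0) (hp 1) (hd 0) (he 0)
  have b1 := mul_add_add_mul_sub_le_two_mul_s15 (hp 0) ((abs_neg _).trans_le (hp 1)) (hd 1) (he 1)
  refine le_of_eq_of_le ?_ ((add_le_add b0 b1).trans_eq (by linarith [h23s 0 1]))
  simp only [chshTwo, corr12, corr123, Fin.sum_univ_two, Fin.val_zero, Fin.val_one]
  ring

lemma chshTwo_sum {n : ℕ} (q : Fin n → ℝ) (P : Fin n → TriCorr) :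
    chshTwo (fun o1 o2 o3 i1 i2 i3 => ∑ l, q l * P l o1 o2 o3 i1 i2 i3) =
      ∑ l, q l * chshTwo (P l) := by
  simp only [chshTwo, corr12, corr123, Fin.sum_univ_two, Finset.mul_sum,
    ← Finset.sum_add_distrib, ← Finset.sum_sub_distrib]
  exact Finset.sum_congr rfl fun l _ => by ring

lemma ATOBL_left.chshTwo_le_two {p : TriCorr} (h : ATOBL_left p) : chshTwo p ≤ 2 := by
  obtain ⟨n, q, p1, p23, hq, hqs, h1, h1s, h23, h23s, hns, hp⟩ := h
  have hp' : p = fun o1 o2 o3 i1 i2 i3 => ∑ l, q l * (p1 l o1 i1 * p23 l o2 o3 i2 i3) := by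
    funext o1 o2 o3 i1 i2 i3
    simp only [hp, mul_assoc]
  rw [hp', chshTwo_sum q fun l o1 o2 o3 i1 i2 i3 => p1 l o1 i1 * p23 l o2 o3 i2 i3]
  calc _ ≤ ∑ l, q l * 2 := Finset.sum_le_sum fun l _ => mul_le_mul_of_nonneg_left
        (chshTwo_bilocal_le_two (h1 l) (h1s l) (h23 l) (h23s l) (hns l)) (hq l)
    _ = 2 := by rw [← Finset.sum_mul, hqs, one_mul]

lemma ATOBL_right.swap {p : TriCorr} (h : ATOBL_right p) :
    ATOBL_left (fun o1 o2 o3 i1 i2 i3 => p o1 o3 o2 i1 i3 i2) := by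
  obtain ⟨n, q, p1, p23, hq, hqs, h1, h1s, h23, h23s, hns, hp⟩ := h
  refine ⟨n, q, p1, fun l o2 o3 i2 i3 => p23 l o3 o2 i3 i2, hq, hqs, h1, h1s,
    fun l o2 o3 i2 i3 => h23 l o3 o2 i3 i2, fun l i2 i3 => ?_,
    fun l o3 i2 i2' i3 => hns l o3 i3 i2 i2', fun o1 o2 o3 i1 i2 i3 => hp o1 o3 o2 i1 i3 i2⟩
  rw [Finset.sum_comm]
  exact h23s l i3 i2

lemma pEpsAlpha_half_swap (ε : ℝ) :
    (fun o1 o2 o3 i1 i2 i3 => pEpsAlpha ε (1 / 2) o1 o3 o2 i1 i3 i2) = pEpsAlpha ε (1 / 2) := by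
  funext o1 o2 o3 i1 i2 i3
  simp only [pEpsAlpha, pEpsR]
  ring

lemma chshTwo_pEpsAlpha_half (ε : ℝ) : chshTwo (pEpsAlpha ε (1 / 2)) = (1 + 5 * ε) / 2 := by
  simp only [chshTwo, corr12, corr123, pEpsAlpha, pEpsR, pEpsL, Fin.sum_univ_two, Fin.val_zero,
    Fin.val_one, zero_ne_one, one_ne_zero, if_true, if_false]
  ring

/-- For `ε ∈ (3/4, 1]`, `P^ε_{1/2}` is neither in `ATOBL_{2←3}` nor in `ATOBL_{2→3}`. -/
theorem pEpsHalf_not_ATOBL (ε : ℝ) (hε : ε ∈ Set.Ioc (3 / 4 : ℝ) 1) :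
    ¬ ATOBL_left (pEpsAlpha ε (1 / 2)) ∧ ¬ ATOBL_right (pEpsAlpha ε (1 / 2)) := by
  have not_left : ¬ ATOBL_left (pEpsAlpha ε (1 / 2)) := fun h => by
    have hle := h.chshTwo_le_two
    rw [chshTwo_pEpsAlpha_half] at hle
    linarith [hε.1]
  exact ⟨not_left, fun h => not_left (pEpsAlpha_half_swap ε ▸ h.swap)⟩
end
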